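/- For every α ∈ [0,1], setting v₊(α) = v + α Δv and s₊(α) = s + α Δs, the componentwise product satisfies the identity v₊(α) s₊(α) = (1 − α) β² + α [ τ² e − p²/4 + α (p²/4 − q²/4) ], where p² and q² denote componentwise squares. -/

import Mathlib

/-- For every `α ∈ [0,1]`, with `v₊(α) = v + α Δv` and `s₊(α) = s + α Δs`,
the componentwise product satisfies
`v₊(α) s₊(α) = (1 − α) β² + α [τ² e − p²/4 + α (p²/4 − q²/4)]`,
where `β² = v s`, `p = d_v + d_s` and `q = d_v − d_s`. -/
theorem componentwise_product_along_newton_step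
    (n : ℕ) (hn : 0 < n)
    (v s dv ds : Fin (2 * n) → ℝ) (τ : ℝ) (hτ : 0 < τ)
    (hv : ∀ i, 0 < v i) (hs : ∀ i, 0 < s i)
    (hdot : 0 ≤ ∑ i, dv i * ds i)
    (hnewton : ∀ i, Real.sqrt (s i / v i) * dv i + Real.sqrt (v i / s i) * ds i
        = 2 * (τ - Real.sqrt (v i * s i)))
    (p q : Fin (2 * n) → ℝ)
    (hp : ∀ i, p i = Real.sqrt (s i / v i) * dv i + Real.sqrt (v i / s i) * ds i)
    (hq : ∀ i, q i = Real.sqrt (s i / v i) * dv i - Real.sqrt (v i / s i) * ds i) :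
    ∀ α : ℝ, 0 ≤ α → α ≤ 1 → ∀ i,
      (v i + α * dv i) * (s i + α * ds i)
        = (1 - α) * (v i * s i)
          + α * (τ ^ 2 - p i ^ 2 / 4 + α * (p i ^ 2 / 4 - q i ^ 2 / 4)) := by
  intro α _ _ i
  have hN := hnewton i
  have hvi := hv i
  have hsi := hs i
  rw [hp i, hq i]
  have hxy : Real.sqrt (s i / v i) * Real.sqrt (v i / s i) = 1 := by
    rw [← Real.sqrt_mul (by positivity), show s i / v i * (v i / s i) = 1 by field_simp,
      Real.sqrt_one]
  have hbx : Real.sqrt (v i * s i) * Real.sqrt (s i / v i) = s i := by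
    rw [← Real.sqrt_mul (by positivity), show v i * s i * (s i / v i) = s i ^ 2 by field_simp,
      Real.sqrt_sq hsi.le]
  have hby : Real.sqrt (v i * s i) * Real.sqrt (v i / s i) = v i := by
    rw [← Real.sqrt_mul (by positivity), show v i * s i * (v i / s i) = v i ^ 2 by field_simp,
      Real.sqrt_sq hvi.le]
  have hbb : Real.sqrt (v i * s i) ^ 2 = v i * s i := Real.sq_sqrt (by positivity)
  generalize Real.sqrt (v i * s i) = b at *
  generalize Real.sqrt (s i / v i) = x at *
  generalize Real.sqrt (v i / s i) = y at *
  linear_combination (-α) * hbb - α * ds i * hby - α * dv i * hbx - α ^ 2 * dv i * ds i * hxy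
    + α / 2 * (b + (x * dv i + y * ds i) / 2 + τ) * hN
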